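/- The L² norm of w tends to zero: lim_{t→∞} ∫₀¹ w(x,t)² dx = 0. -/

import Mathlib

open MeasureTheory Real Set Filter Topology

/-- A classical solution on `[0,1] × [0,∞)` of the rescaled stress-free
one-dimensional compressible Navier–Stokes system
`u_t + u = v_x`, `v_t = ((v_x - θ)/u)_x`,
`θ_t = -θ v_x/u + v_x²/u + (θ^β θ_x/u)_x` (β > 0),
with stress-free, thermally insulated boundary conditions and positive data. -/
structure NSSol where
  β : ℝ
  hβ : 0 < β
  u : ℝ → ℝ → ℝ
  v : ℝ → ℝ → ℝ
  θ : ℝ → ℝ → ℝ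
  ux : ℝ → ℝ → ℝ
  ut : ℝ → ℝ → ℝ
  vx : ℝ → ℝ → ℝ
  vt : ℝ → ℝ → ℝ
  vxx : ℝ → ℝ → ℝ
  θx : ℝ → ℝ → ℝ
  θt : ℝ → ℝ → ℝ
  θxx : ℝ → ℝ → ℝ
  hu_pos : ∀ x ∈ Icc (0:ℝ) 1, ∀ t ∈ Ici (0:ℝ), 0 < u x t
  hθ_pos : ∀ x ∈ Icc (0:ℝ) 1, ∀ t ∈ Ici (0:ℝ), 0 < θ x t
  hux : ∀ x ∈ Icc (0:ℝ) 1, ∀ t ∈ Ici (0:ℝ),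
    HasDerivWithinAt (fun y => u y t) (ux x t) (Icc 0 1) x
  hut : ∀ x ∈ Icc (0:ℝ) 1, ∀ t ∈ Ici (0:ℝ),
    HasDerivWithinAt (fun s => u x s) (ut x t) (Ici 0) t
  hvx : ∀ x ∈ Icc (0:ℝ) 1, ∀ t ∈ Ici (0:ℝ),
    HasDerivWithinAt (fun y => v y t) (vx x t) (Icc 0 1) x
  hvt : ∀ x ∈ Icc (0:ℝ) 1, ∀ t ∈ Ici (0:ℝ),
    HasDerivWithinAt (fun s => v x s) (vt x t) (Ici 0) t
  hvxx : ∀ x ∈ Icc (0:ℝ) 1, ∀ t ∈ Ici (0:ℝ),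
    HasDerivWithinAt (fun y => vx y t) (vxx x t) (Icc 0 1) x
  hθx : ∀ x ∈ Icc (0:ℝ) 1, ∀ t ∈ Ici (0:ℝ),
    HasDerivWithinAt (fun y => θ y t) (θx x t) (Icc 0 1) x
  hθt : ∀ x ∈ Icc (0:ℝ) 1, ∀ t ∈ Ici (0:ℝ),
    HasDerivWithinAt (fun s => θ x s) (θt x t) (Ici 0) t
  hθxx : ∀ x ∈ Icc (0:ℝ) 1, ∀ t ∈ Ici (0:ℝ),
    HasDerivWithinAt (fun y => θx y t) (θxx x t) (Icc 0 1) x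
  hu_cont : ContinuousOn (Function.uncurry u) (Icc 0 1 ×ˢ Ici 0)
  hv_cont : ContinuousOn (Function.uncurry v) (Icc 0 1 ×ˢ Ici 0)
  hθ_cont : ContinuousOn (Function.uncurry θ) (Icc 0 1 ×ˢ Ici 0)
  hux_cont : ContinuousOn (Function.uncurry ux) (Icc 0 1 ×ˢ Ici 0)
  hut_cont : ContinuousOn (Function.uncurry ut) (Icc 0 1 ×ˢ Ici 0)
  hvx_cont : ContinuousOn (Function.uncurry vx) (Icc 0 1 ×ˢ Ici 0)
  hvt_cont : ContinuousOn (Function.uncurry vt) (Icc 0 1 ×ˢ Ici 0)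
  hvxx_cont : ContinuousOn (Function.uncurry vxx) (Icc 0 1 ×ˢ Ici 0)
  hθx_cont : ContinuousOn (Function.uncurry θx) (Icc 0 1 ×ˢ Ici 0)
  hθt_cont : ContinuousOn (Function.uncurry θt) (Icc 0 1 ×ˢ Ici 0)
  hθxx_cont : ContinuousOn (Function.uncurry θxx) (Icc 0 1 ×ˢ Ici 0)
  mass : ∀ x ∈ Icc (0:ℝ) 1, ∀ t ∈ Ici (0:ℝ), ut x t + u x t = vx x t
  momentum : ∀ x ∈ Icc (0:ℝ) 1, ∀ t ∈ Ici (0:ℝ),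
    HasDerivWithinAt (fun y => (vx y t - θ y t) / u y t) (vt x t) (Icc 0 1) x
  energyEq : ∀ x ∈ Icc (0:ℝ) 1, ∀ t ∈ Ici (0:ℝ),
    HasDerivWithinAt (fun y => θ y t ^ β * θx y t / u y t)
      (θt x t + θ x t * vx x t / u x t - (vx x t) ^ 2 / u x t) (Icc 0 1) x
  bc0 : ∀ t ∈ Ici (0:ℝ), (vx 0 t - θ 0 t) / u 0 t = 0
  bc1 : ∀ t ∈ Ici (0:ℝ), (vx 1 t - θ 1 t) / u 1 t = 0
  bcθ0 : ∀ t ∈ Ici (0:ℝ), θx 0 t = 0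
  bcθ1 : ∀ t ∈ Ici (0:ℝ), θx 1 t = 0

namespace NSSol

/-- The initial energy `E₀ = ∫₀¹ (v₀²/2 + θ₀) dx`. -/
noncomputable def E₀ (S : NSSol) : ℝ := ∫ x in (0:ℝ)..1, ((S.v x 0) ^ 2 / 2 + S.θ x 0)

/-- The dissipation functional
`V(t) = ∫₀¹ (θ^β θ_x²/(uθ²) + (v_x − θ)²/(uθ)) dx`. -/
noncomputable def V (S : NSSol) (t : ℝ) : ℝ :=
  ∫ x in (0:ℝ)..1,
    (S.θ x t ^ S.β * (S.θx x t) ^ 2 / (S.u x t * (S.θ x t) ^ 2)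
      + (S.vx x t - S.θ x t) ^ 2 / (S.u x t * S.θ x t))

/-- The auxiliary velocity
`w(x,t) = v(x,t) − ∫₀¹ v₀ dξ − ∫₀ˣ u(ξ,t) dξ + ∫₀¹∫₀^ξ u(η,t) dη dξ`,
which satisfies `w_x = v_x − u` and `∫₀¹ w dx = 0`. -/
noncomputable def w (S : NSSol) (x t : ℝ) : ℝ :=
  S.v x t - (∫ ξ in (0:ℝ)..1, S.v ξ 0) - (∫ ξ in (0:ℝ)..x, S.u ξ t)
    + ∫ ξ in (0:ℝ)..1, ∫ η in (0:ℝ)..ξ, S.u η t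

/-- The asymptotic state `A = 2√(36 + 3(2E₀ − (∫₀¹ v₀ dx)²)) − 12`. -/
noncomputable def A (S : NSSol) : ℝ :=
  2 * Real.sqrt (36 + 3 * (2 * S.E₀ - (∫ x in (0:ℝ)..1, S.v x 0) ^ 2)) - 12

end NSSol

/-! ### Calculus on the unit interval -/

section Calculus

theorem integral_mono_unit {f g : ℝ → ℝ} (hf : ContinuousOn f (Icc 0 1))
    (hg : ContinuousOn g (Icc 0 1)) (h : ∀ x ∈ Icc (0:ℝ) 1, f x ≤ g x) :
    ∫ x in (0:ℝ)..1, f x ≤ ∫ x in (0:ℝ)..1, g x :=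
  intervalIntegral.integral_mono_on zero_le_one
    (hf.intervalIntegrable_of_Icc zero_le_one) (hg.intervalIntegrable_of_Icc zero_le_one) h

theorem integral_unit_add_mul {f g : ℝ → ℝ} (hf : ContinuousOn f (Icc 0 1))
    (hg : ContinuousOn g (Icc 0 1)) (a b : ℝ) :
    ∫ x in (0:ℝ)..1, (a * f x + b * g x)
      = a * (∫ x in (0:ℝ)..1, f x) + b * ∫ x in (0:ℝ)..1, g x := by
  have hf' := hf.intervalIntegrable_of_Icc (μ := volume) zero_le_one
  have hg' := hg.intervalIntegrable_of_Icc (μ := volume) zero_le_one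
  rw [intervalIntegral.integral_add (hf'.const_mul a) (hg'.const_mul b),
    intervalIntegral.integral_const_mul, intervalIntegral.integral_const_mul]

theorem integral_eq_sub_of_hasDerivWithinAt_Icc {F F' : ℝ → ℝ} {a b : ℝ} (hab : a ≤ b)
    (hF : ∀ x ∈ Icc a b, HasDerivWithinAt F (F' x) (Icc a b) x)
    (hF' : ContinuousOn F' (Icc a b)) :
    ∫ x in a..b, F' x = F b - F a :=
  intervalIntegral.integral_eq_sub_of_hasDerivAt_of_le hab
    (fun x hx => (hF x hx).continuousWithinAt)
    (fun x hx => (hF x (Ioo_subset_Icc_self hx)).hasDerivAt (Icc_mem_nhds hx.1 hx.2))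
    (hF'.intervalIntegrable_of_Icc hab)

theorem abs_sub_le_integral_abs_deriv {F F' : ℝ → ℝ}
    (hF : ∀ x ∈ Icc (0:ℝ) 1, HasDerivWithinAt F (F' x) (Icc 0 1) x)
    (hF' : ContinuousOn F' (Icc 0 1)) {x y : ℝ} (hx : x ∈ Icc (0:ℝ) 1) (hy : y ∈ Icc (0:ℝ) 1) :
    |F x - F y| ≤ ∫ z in (0:ℝ)..1, |F' z| := by
  wlog hyx : y ≤ x generalizing x y
  · rw [abs_sub_comm]
    exact this hy hx (le_of_not_ge hyx)
  have hsub : Icc y x ⊆ Icc 0 1 := Icc_subset_Icc hy.1 hx.2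
  rw [← integral_eq_sub_of_hasDerivWithinAt_Icc hyx (fun z hz => (hF z (hsub hz)).mono hsub)
    (hF'.mono hsub)]
  refine (intervalIntegral.abs_integral_le_integral_abs hyx).trans ?_
  exact intervalIntegral.integral_mono_interval hy.1 hyx hx.2
    (Eventually.of_forall fun z => abs_nonneg _) (hF'.abs.intervalIntegrable_of_Icc zero_le_one)

/-- Cauchy–Schwarz on the unit interval, for continuous functions with `N² ≤ A B` pointwise. -/
theorem sq_integral_le_mul_integral {N A B : ℝ → ℝ} (hN : ContinuousOn N (Icc 0 1))
    (hA : ContinuousOn A (Icc 0 1)) (hB : ContinuousOn B (Icc 0 1))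
    (hA0 : ∀ x ∈ Icc (0:ℝ) 1, 0 ≤ A x) (hB0 : ∀ x ∈ Icc (0:ℝ) 1, 0 ≤ B x)
    (h : ∀ x ∈ Icc (0:ℝ) 1, N x ^ 2 ≤ A x * B x) :
    (∫ x in (0:ℝ)..1, N x) ^ 2 ≤ (∫ x in (0:ℝ)..1, A x) * ∫ x in (0:ℝ)..1, B x := by
  have key : ∀ l : ℝ, 0 ≤ (∫ x in (0:ℝ)..1, A x) * (l * l)
      + (-2 * ∫ x in (0:ℝ)..1, N x) * l + ∫ x in (0:ℝ)..1, B x := by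
    intro l
    have h1 : 0 ≤ ∫ x in (0:ℝ)..1, (1 * ((l * l) * A x + (-2 * l) * N x) + 1 * B x) := by
      refine intervalIntegral.integral_nonneg zero_le_one fun x hx => ?_
      rcases (hA0 x hx).eq_or_lt with h0 | h0
      · have : N x = 0 := by
          have := h x hx
          rw [← h0, zero_mul] at this
          exact pow_eq_zero_iff two_ne_zero |>.1 (le_antisymm this (sq_nonneg _))
        rw [← h0, this]
        simpa using hB0 x hx
      · refine nonneg_of_mul_nonneg_right (a := A x) ?_ h0
        nlinarith [h x hx, sq_nonneg (l * A x - N x)]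
    rw [integral_unit_add_mul (by fun_prop) hB, integral_unit_add_mul hA hN] at h1
    linarith
  have := discrim_le_zero key
  rw [discrim] at this
  linarith

end Calculus

/-! ### Time-dependent integrals over the strip -/

section Strip

theorem continuousOn_slice {F : ℝ → ℝ → ℝ}
    (hF : ContinuousOn (Function.uncurry F) (Icc 0 1 ×ˢ Ici 0)) {t : ℝ} (ht : 0 ≤ t) :
    ContinuousOn (fun x => F x t) (Icc 0 1) :=
  hF.comp (f := fun x => (x, t)) (by fun_prop) fun _ hx => ⟨hx, ht⟩

theorem continuousOn_primitive_strip {F : ℝ → ℝ → ℝ}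
    (hF : ContinuousOn (Function.uncurry F) (Icc 0 1 ×ˢ Ici 0)) :
    ContinuousOn (Function.uncurry fun x t => ∫ y in (0:ℝ)..x, F y t) (Icc 0 1 ×ˢ Ici 0) := by
  let G : ℝ × ℝ → ℝ → ℝ := fun p y => F (max 0 (min y 1)) (max p.2 0)
  have hG : Continuous (Function.uncurry G) := by
    have : Function.uncurry G = Function.uncurry F ∘
        fun q : (ℝ × ℝ) × ℝ => (max 0 (min q.2 1), max q.1.2 0) := rfl
    rw [this]
    refine hF.comp_continuous (by fun_prop) fun q => ⟨⟨le_max_left _ _, ?_⟩, mem_Ici.2 (le_max_right _ _)⟩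
    exact max_le zero_le_one (min_le_right _ _)
  have hc : Continuous fun p : ℝ × ℝ => ∫ y in (0:ℝ)..p.1, G p y :=
    intervalIntegral.continuous_parametric_intervalIntegral_of_continuous hG continuous_fst
  refine hc.continuousOn.congr fun p hp => ?_
  refine intervalIntegral.integral_congr fun y hy => ?_
  have h0 := hp.1.1
  rw [uIcc_of_le h0] at hy
  have h1 : min y 1 = y := min_eq_left (hy.2.trans hp.1.2)
  have h2 : max 0 y = y := max_eq_right hy.1
  have h3 : max p.2 0 = p.2 := max_eq_left hp.2
  simp only [G, h1, h2, h3]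

theorem continuousOn_integral_strip {F : ℝ → ℝ → ℝ}
    (hF : ContinuousOn (Function.uncurry F) (Icc 0 1 ×ˢ Ici 0)) :
    ContinuousOn (fun t => ∫ y in (0:ℝ)..1, F y t) (Ici 0) :=
  (continuousOn_primitive_strip hF).comp (f := fun t => ((1:ℝ), t)) (by fun_prop)
    fun _ ht => ⟨⟨zero_le_one, le_rfl⟩, ht⟩

theorem hasDerivAt_integral_strip {F F' : ℝ → ℝ → ℝ}
    (hF : ContinuousOn (Function.uncurry F) (Icc 0 1 ×ˢ Ici 0))
    (hF' : ContinuousOn (Function.uncurry F') (Icc 0 1 ×ˢ Ici 0))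
    (hd : ∀ x ∈ Icc (0:ℝ) 1, ∀ t > 0, HasDerivAt (F x) (F' x t) t)
    {b : ℝ} (hb : b ∈ Icc (0:ℝ) 1) {t : ℝ} (ht : 0 < t) :
    HasDerivAt (fun s => ∫ x in (0:ℝ)..b, F x s) (∫ x in (0:ℝ)..b, F' x t) t := by
  obtain ⟨C, hC⟩ := (isCompact_Icc.prod (isCompact_Icc (a := 0) (b := 2 * t))).exists_bound_of_continuousOn
    (hF'.mono (prod_mono subset_rfl Icc_subset_Ici_self : Icc (0:ℝ) 1 ×ˢ Icc 0 (2 * t) ⊆ _))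
  have hsub : uIoc 0 b ⊆ Icc 0 1 := by
    rw [uIoc_of_le hb.1]
    exact fun x hx => ⟨hx.1.le, hx.2.trans hb.2⟩
  have hI : ∀ {G : ℝ → ℝ → ℝ}, ContinuousOn (Function.uncurry G) (Icc 0 1 ×ˢ Ici 0) →
      ∀ s : ℝ, 0 ≤ s → IntervalIntegrable (fun x => G x s) volume 0 b := fun hG s hs =>
    ((continuousOn_slice hG hs).mono (Icc_subset_Icc_right hb.2)).intervalIntegrable_of_Icc hb.1
  refine (intervalIntegral.hasDerivAt_integral_of_dominated_loc_of_deriv_le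
    (F := fun s x => F x s) (F' := fun s x => F' x s) (bound := fun _ => C)
    (s := Ioo 0 (2 * t)) (Ioo_mem_nhds ht (by linarith)) ?_ (hI hF t ht.le)
    (intervalIntegrable_iff.1 (hI hF' t ht.le)).aestronglyMeasurable ?_ intervalIntegrable_const ?_).2
  · filter_upwards [Ioi_mem_nhds ht] with s hs
    exact (intervalIntegrable_iff.1 (hI hF s (le_of_lt hs))).aestronglyMeasurable
  · exact Eventually.of_forall fun x hx s hs =>
      hC (x, s) ⟨hsub hx, hs.1.le, hs.2.le⟩
  · exact Eventually.of_forall fun x hx s hs => hd x (hsub hx) s hs.1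

end Strip

/-! ### Differential inequalities -/

section Comparison

theorem le_of_hasDerivAt_nonpos {k k' : ℝ → ℝ} {s t : ℝ} (hst : s ≤ t)
    (hc : ContinuousOn k (Icc s t)) (hk : ∀ r ∈ Ioo s t, HasDerivAt k (k' r) r)
    (h : ∀ r ∈ Ioo s t, k' r ≤ 0) : k t ≤ k s := by
  refine antitoneOn_of_deriv_nonpos (convex_Icc s t) hc ?_ ?_ (left_mem_Icc.2 hst)
    (right_mem_Icc.2 hst) hst
  · rw [interior_Icc]
    exact fun r hr => (hk r hr).differentiableAt.differentiableWithinAt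
  · rw [interior_Icc]
    intro r hr
    rw [(hk r hr).deriv]
    exact h r hr

theorem eq_of_hasDerivAt_zero {k : ℝ → ℝ} {s t : ℝ} (hst : s ≤ t)
    (hc : ContinuousOn k (Icc s t)) (hk : ∀ r ∈ Ioo s t, HasDerivAt k 0 r) : k t = k s := by
  refine le_antisymm (le_of_hasDerivAt_nonpos hst hc hk fun _ _ => le_rfl) ?_
  have := le_of_hasDerivAt_nonpos (k := fun r => -k r) hst hc.neg
    (fun r hr => (hk r hr).neg) fun _ _ => neg_zero.le
  linarith

theorem le_of_hasDerivAt_le {h h' W W' : ℝ → ℝ} {a b s t : ℝ} (hs : 0 < s) (hst : s ≤ t)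
    (hh : ∀ r > 0, HasDerivAt h (h' r) r) (hW : ∀ r > 0, HasDerivAt W (W' r) r)
    (H : ∀ r ∈ Icc s t, h' r ≤ a + b * W' r) :
    h t ≤ h s + a * (t - s) + b * (W t - W s) := by
  have hd : ∀ r > 0, HasDerivAt (fun r => h r - a * r - b * W r) (h' r - a * 1 - b * W' r) r :=
    fun r hr => ((hh r hr).sub ((hasDerivAt_id r).const_mul a)).sub ((hW r hr).const_mul b)
  have := le_of_hasDerivAt_nonpos hst
    (fun r hr => (hd r (hs.trans_le hr.1)).continuousAt.continuousWithinAt)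
    (fun r hr => hd r (hs.trans hr.1))
    (fun r hr => by linarith [H r (Ioo_subset_Icc_self hr)])
  linarith

/-- Grönwall-type bound for `h' ≤ -h + a + b W'` with `W` nondecreasing. -/
theorem le_of_hasDerivAt_le_neg_self {h h' W W' : ℝ → ℝ} {a b s t : ℝ} (hs : 0 < s) (hst : s ≤ t)
    (hb : 0 ≤ b)
    (hh : ∀ r > 0, HasDerivAt h (h' r) r) (hW : ∀ r > 0, HasDerivAt W (W' r) r)
    (hW0 : ∀ r > 0, 0 ≤ W' r)
    (H : ∀ r ∈ Icc s t, h' r ≤ -h r + a + b * W' r) :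
    h t ≤ exp (-(t - s)) * (h s - a) + a + b * (W t - W s) := by
  have hd : ∀ r > 0, HasDerivAt (fun r => exp r * (h r - a - b * (W r - W s)))
      (exp r * (h r - a - b * (W r - W s)) + exp r * (h' r - b * W' r)) r := fun r hr =>
    (Real.hasDerivAt_exp r).mul (((hh r hr).sub_const a).sub (((hW r hr).sub_const _).const_mul b))
  have hmono : ∀ r ∈ Icc s t, W s ≤ W r := by
    intro r hr
    have := le_of_hasDerivAt_le (a := 0) (b := 0) (h := fun r => -W r) (h' := fun r => -W' r)
      hs hr.1 (fun r hr => (hW r hr).neg) hW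
      (fun q hq => by linarith [hW0 q (hs.trans_le hq.1)])
    linarith
  have := le_of_hasDerivAt_nonpos hst
    (fun r hr => (hd r (hs.trans_le hr.1)).continuousAt.continuousWithinAt)
    (fun r hr => hd r (hs.trans hr.1))
    (fun r hr => by
      have hr' := Ioo_subset_Icc_self hr
      have h1 := H r hr'
      have h2 := mul_nonneg hb (sub_nonneg.2 (hmono r hr'))
      rw [← mul_add]
      exact mul_nonpos_of_nonneg_of_nonpos (exp_pos r).le (by linarith))
  simp only [sub_self, mul_zero, sub_zero] at this
  have he : exp (-(t - s)) = exp s / exp t := by rw [← Real.exp_sub]; congr 1; ring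
  have h3 : h t - a - b * (W t - W s) ≤ exp s * (h s - a) / exp t := by
    rw [le_div_iff₀ (exp_pos t)]
    linarith
  rw [he, div_mul_eq_mul_div]
  linarith

end Comparison

namespace NSSol

variable (S : NSSol)

/-- The stress `(v_x - θ)/u`. -/
noncomputable def stress (x t : ℝ) : ℝ := (S.vx x t - S.θ x t) / S.u x t

/-- The integrand of `V`. -/
noncomputable def dissipation (x t : ℝ) : ℝ :=
  S.θ x t ^ S.β * (S.θx x t) ^ 2 / (S.u x t * (S.θ x t) ^ 2)
    + (S.vx x t - S.θ x t) ^ 2 / (S.u x t * S.θ x t)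

/-- The mean-free primitive of `u`. -/
noncomputable def primU (x t : ℝ) : ℝ :=
  (∫ ξ in (0:ℝ)..x, S.u ξ t) - ∫ ξ in (0:ℝ)..1, ∫ η in (0:ℝ)..ξ, S.u η t

/-- The functional `∫₀¹ (log θ + x v) dx`, whose time derivative is `V`. -/
noncomputable def entropy (t : ℝ) : ℝ :=
  ∫ x in (0:ℝ)..1, (Real.log (S.θ x t) + x * S.v x t)

theorem V_eq (t : ℝ) : S.V t = ∫ x in (0:ℝ)..1, S.dissipation x t := rfl

theorem w_eq (x t : ℝ) : S.w x t = S.v x t - (∫ ξ in (0:ℝ)..1, S.v ξ 0) - S.primU x t := by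
  rw [w, primU]
  ring

/-! ### Regularity of the derived quantities -/

theorem hasDerivAt_u {x : ℝ} (hx : x ∈ Icc (0:ℝ) 1) {t : ℝ} (ht : 0 < t) :
    HasDerivAt (S.u x) (S.ut x t) t := (S.hut x hx t ht.le).hasDerivAt (Ici_mem_nhds ht)

theorem hasDerivAt_v {x : ℝ} (hx : x ∈ Icc (0:ℝ) 1) {t : ℝ} (ht : 0 < t) :
    HasDerivAt (S.v x) (S.vt x t) t := (S.hvt x hx t ht.le).hasDerivAt (Ici_mem_nhds ht)

theorem hasDerivAt_θ {x : ℝ} (hx : x ∈ Icc (0:ℝ) 1) {t : ℝ} (ht : 0 < t) :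
    HasDerivAt (S.θ x) (S.θt x t) t := (S.hθt x hx t ht.le).hasDerivAt (Ici_mem_nhds ht)

theorem continuousOn_stress :
    ContinuousOn (Function.uncurry S.stress) (Icc 0 1 ×ˢ Ici 0) :=
  (S.hvx_cont.sub S.hθ_cont).div S.hu_cont fun p hp => (S.hu_pos p.1 hp.1 p.2 hp.2).ne'

theorem continuousOn_dissipation :
    ContinuousOn (Function.uncurry S.dissipation) (Icc 0 1 ×ˢ Ici 0) := by
  have hu : ∀ p ∈ Icc (0:ℝ) 1 ×ˢ Ici (0:ℝ), S.u p.1 p.2 ≠ 0 :=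
    fun p hp => (S.hu_pos p.1 hp.1 p.2 hp.2).ne'
  have hθ : ∀ p ∈ Icc (0:ℝ) 1 ×ˢ Ici (0:ℝ), S.θ p.1 p.2 ≠ 0 :=
    fun p hp => (S.hθ_pos p.1 hp.1 p.2 hp.2).ne'
  refine ContinuousOn.add ?_ ?_
  · exact ((S.hθ_cont.rpow_const fun p hp => Or.inl (hθ p hp)).mul (S.hθx_cont.pow 2)).div
      (S.hu_cont.mul (S.hθ_cont.pow 2)) fun p hp => mul_ne_zero (hu p hp) (pow_ne_zero 2 (hθ p hp))
  · exact ((S.hvx_cont.sub S.hθ_cont).pow 2).div (S.hu_cont.mul S.hθ_cont)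
      fun p hp => mul_ne_zero (hu p hp) (hθ p hp)

theorem dissipation_nonneg {x : ℝ} (hx : x ∈ Icc (0:ℝ) 1) {t : ℝ} (ht : 0 ≤ t) :
    0 ≤ S.dissipation x t := by
  have hu := S.hu_pos x hx t ht
  have hθ := S.hθ_pos x hx t ht
  rw [dissipation]
  positivity

theorem V_nonneg {t : ℝ} (ht : 0 ≤ t) : 0 ≤ S.V t :=
  intervalIntegral.integral_nonneg zero_le_one fun _ hx => S.dissipation_nonneg hx ht

theorem continuousOn_primU :
    ContinuousOn (Function.uncurry S.primU) (Icc 0 1 ×ˢ Ici 0) := by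
  have h := continuousOn_primitive_strip S.hu_cont
  exact h.sub ((continuousOn_integral_strip h).comp continuousOn_snd fun _ hp => hp.2)

theorem continuousOn_w :
    ContinuousOn (Function.uncurry S.w) (Icc 0 1 ×ˢ Ici 0) := by
  have h : Function.uncurry S.w = fun p =>
      Function.uncurry S.v p - (∫ ξ in (0:ℝ)..1, S.v ξ 0) - Function.uncurry S.primU p := by
    funext p
    exact S.w_eq p.1 p.2
  rw [h]
  exact (S.hv_cont.sub continuousOn_const).sub S.continuousOn_primU

theorem hasDerivWithinAt_primU {x : ℝ} (hx : x ∈ Icc (0:ℝ) 1) {t : ℝ} (ht : 0 ≤ t) :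
    HasDerivWithinAt (fun y => S.primU y t) (S.u x t) (Icc 0 1) x := by
  have hc := continuousOn_slice S.hu_cont ht
  refine HasDerivWithinAt.sub_const _ ?_
  have : Fact (x ∈ Icc (0:ℝ) 1) := ⟨hx⟩
  exact intervalIntegral.integral_hasDerivWithinAt_right
    ((hc.mono (Icc_subset_Icc_right hx.2)).intervalIntegrable_of_Icc hx.1)
    (hc.stronglyMeasurableAtFilter_nhdsWithin measurableSet_Icc x) (hc x hx)

/-! ### Conservation laws -/

theorem stress_zero {t : ℝ} (ht : 0 ≤ t) : S.stress 0 t = 0 := S.bc0 t ht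

theorem stress_one {t : ℝ} (ht : 0 ≤ t) : S.stress 1 t = 0 := S.bc1 t ht

theorem hasDerivWithinAt_stress {x : ℝ} (hx : x ∈ Icc (0:ℝ) 1) {t : ℝ} (ht : 0 ≤ t) :
    HasDerivWithinAt (fun y => S.stress y t) (S.vt x t) (Icc 0 1) x := S.momentum x hx t ht

theorem integral_v {t : ℝ} (ht : 0 ≤ t) :
    ∫ x in (0:ℝ)..1, S.v x t = ∫ x in (0:ℝ)..1, S.v x 0 := by
  refine eq_of_hasDerivAt_zero (k := fun t => ∫ x in (0:ℝ)..1, S.v x t) ht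
    ((continuousOn_integral_strip S.hv_cont).mono Icc_subset_Ici_self) fun r hr => ?_
  have h := hasDerivAt_integral_strip S.hv_cont S.hvt_cont (fun x hx t ht => S.hasDerivAt_v hx ht)
    ⟨zero_le_one, le_rfl⟩ hr.1
  rwa [integral_eq_sub_of_hasDerivWithinAt_Icc zero_le_one
    (fun x hx => S.hasDerivWithinAt_stress hx hr.1.le) (continuousOn_slice S.hvt_cont hr.1.le),
    S.stress_zero hr.1.le, S.stress_one hr.1.le, sub_zero] at h

theorem continuousOn_energy_density :
    ContinuousOn (Function.uncurry fun x t => S.v x t ^ 2 / 2 + S.θ x t) (Icc 0 1 ×ˢ Ici 0) :=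
  ((S.hv_cont.pow 2).div_const 2).add S.hθ_cont

theorem energy_eq {t : ℝ} (ht : 0 ≤ t) :
    ∫ x in (0:ℝ)..1, (S.v x t ^ 2 / 2 + S.θ x t) = S.E₀ := by
  have hc' : ContinuousOn (Function.uncurry fun x t => S.v x t * S.vt x t + S.θt x t)
      (Icc 0 1 ×ˢ Ici 0) := (S.hv_cont.mul S.hvt_cont).add S.hθt_cont
  refine eq_of_hasDerivAt_zero (k := fun t => ∫ x in (0:ℝ)..1, (S.v x t ^ 2 / 2 + S.θ x t)) ht
    ((continuousOn_integral_strip S.continuousOn_energy_density).mono Icc_subset_Ici_self)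
    fun r hr => ?_
  have hr0 := hr.1.le
  have h := hasDerivAt_integral_strip S.continuousOn_energy_density hc'
    (fun x hx t ht => by
      refine ((((S.hasDerivAt_v hx ht).pow 2).div_const 2).add (S.hasDerivAt_θ hx ht)).congr_deriv ?_
      push_cast
      ring) ⟨zero_le_one, le_rfl⟩ hr.1
  rwa [integral_eq_sub_of_hasDerivWithinAt_Icc (F := fun y => S.v y r * S.stress y r
      + S.θ y r ^ S.β * S.θx y r / S.u y r) zero_le_one
    (fun x hx => by
      refine (((S.hvx x hx r hr0).mul (S.hasDerivWithinAt_stress hx hr0)).add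
        (S.energyEq x hx r hr0)).congr_deriv ?_
      have := (S.hu_pos x hx r hr0).ne'
      rw [stress]
      field_simp
      ring) (continuousOn_slice hc' hr0),
    S.stress_zero hr0, S.stress_one hr0, S.bcθ0 r hr0, S.bcθ1 r hr0, mul_zero, mul_zero,
    mul_zero, mul_zero, zero_div, zero_div, sub_self] at h

theorem integral_θ_le {t : ℝ} (ht : 0 ≤ t) : ∫ x in (0:ℝ)..1, S.θ x t ≤ S.E₀ := by
  rw [← S.energy_eq ht]
  exact integral_mono_unit (continuousOn_slice S.hθ_cont ht)
    (continuousOn_slice S.continuousOn_energy_density ht)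
    fun x _ => le_add_of_nonneg_left (by positivity)

theorem E₀_nonneg : 0 ≤ S.E₀ :=
  (intervalIntegral.integral_nonneg zero_le_one fun x hx =>
    (S.hθ_pos x hx 0 (mem_Ici.2 le_rfl)).le).trans (S.integral_θ_le le_rfl)

theorem integral_energy_density_add_half {t : ℝ} (ht : 0 ≤ t) :
    ∫ x in (0:ℝ)..1, (S.v x t ^ 2 / 2 + S.θ x t + 1 / 2) = S.E₀ + 1 / 2 := by
  rw [intervalIntegral.integral_add
    ((continuousOn_slice S.continuousOn_energy_density ht).intervalIntegrable_of_Icc zero_le_one)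
    intervalIntegrable_const, S.energy_eq ht]
  simp

theorem continuousOn_energy_density_add_half {t : ℝ} (ht : 0 ≤ t) :
    ContinuousOn (fun x => S.v x t ^ 2 / 2 + S.θ x t + 1 / 2) (Icc 0 1) :=
  (continuousOn_slice S.continuousOn_energy_density ht).add continuousOn_const

theorem integral_abs_v_le {t : ℝ} (ht : 0 ≤ t) :
    ∫ x in (0:ℝ)..1, |S.v x t| ≤ S.E₀ + 1 / 2 := by
  rw [← S.integral_energy_density_add_half ht]
  refine integral_mono_unit (continuousOn_slice S.hv_cont ht).abs
    (S.continuousOn_energy_density_add_half ht) fun x hx => ?_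
  nlinarith [S.hθ_pos x hx t ht, sq_abs (S.v x t), sq_nonneg (|S.v x t| - 1)]

theorem abs_integral_v_le {x : ℝ} (hx : x ∈ Icc (0:ℝ) 1) {t : ℝ} (ht : 0 ≤ t) :
    |∫ ξ in (0:ℝ)..x, S.v ξ t| ≤ S.E₀ + 1 / 2 := by
  refine (intervalIntegral.abs_integral_le_integral_abs hx.1).trans
    (le_trans ?_ (S.integral_abs_v_le ht))
  exact intervalIntegral.integral_mono_interval le_rfl hx.1 hx.2
    (Eventually.of_forall fun z => abs_nonneg _)
    ((continuousOn_slice S.hv_cont ht).abs.intervalIntegrable_of_Icc zero_le_one)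

/-! ### Entropy production -/

theorem continuousOn_entropy_density :
    ContinuousOn (Function.uncurry fun x t => Real.log (S.θ x t) + x * S.v x t)
      (Icc 0 1 ×ˢ Ici 0) :=
  (S.hθ_cont.log fun p hp => (S.hθ_pos p.1 hp.1 p.2 hp.2).ne').add
    (continuousOn_fst.mul S.hv_cont)

theorem hasDerivAt_entropy : ∀ t > 0, HasDerivAt S.entropy (S.V t) t := by
  intro t ht
  have ht0 := ht.le
  have hc' : ContinuousOn (Function.uncurry fun x t => S.θt x t / S.θ x t + x * S.vt x t)
      (Icc 0 1 ×ˢ Ici 0) :=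
    (S.hθt_cont.div S.hθ_cont fun p hp => (S.hθ_pos p.1 hp.1 p.2 hp.2).ne').add
      (continuousOn_fst.mul S.hvt_cont)
  have h := hasDerivAt_integral_strip S.continuousOn_entropy_density hc'
    (fun x hx t ht => ((S.hasDerivAt_θ hx ht).log (S.hθ_pos x hx t ht.le).ne').add
      ((S.hasDerivAt_v hx ht).const_mul x)) ⟨zero_le_one, le_rfl⟩ ht
  refine h.congr_deriv ?_
  have hD := continuousOn_slice S.continuousOn_dissipation ht0
  have hP := continuousOn_slice hc' ht0
  have hsub := integral_eq_sub_of_hasDerivWithinAt_Icc zero_le_one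
    (F := fun y => y * S.stress y t + S.θ y t ^ S.β * S.θx y t / S.u y t / S.θ y t)
    (F' := fun y => 1 * (S.θt y t / S.θ y t + y * S.vt y t) + (-1) * S.dissipation y t)
    (fun x hx => by
      have hu := (S.hu_pos x hx t ht0).ne'
      have hθ := (S.hθ_pos x hx t ht0).ne'
      refine (((hasDerivWithinAt_id x _).mul (S.hasDerivWithinAt_stress hx ht0)).add
        ((S.energyEq x hx t ht0).div (S.hθx x hx t ht0) hθ)).congr_deriv ?_
      simp only [stress, dissipation, id]
      field_simp
      ring) ((continuousOn_const.mul hP).add (continuousOn_const.mul hD))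
  rw [integral_unit_add_mul hP hD, S.stress_one ht0, S.stress_zero ht0, S.bcθ0 t ht0,
    S.bcθ1 t ht0, ← V_eq] at hsub
  simp only [mul_zero, zero_div, add_zero, sub_zero] at hsub
  linarith

theorem entropy_mono {s t : ℝ} (hs : 0 < s) (hst : s ≤ t) : S.entropy s ≤ S.entropy t := by
  have := le_of_hasDerivAt_le (a := 0) (b := 0) (h := fun r => -S.entropy r)
    (h' := fun r => -S.V r) hs hst (fun r hr => (S.hasDerivAt_entropy r hr).neg)
    S.hasDerivAt_entropy (fun q hq => by linarith [S.V_nonneg (hs.le.trans hq.1)])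
  linarith

theorem mul_v_le {x : ℝ} (hx : x ∈ Icc (0:ℝ) 1) (t : ℝ) :
    x * S.v x t ≤ S.v x t ^ 2 / 2 + 1 / 2 := by
  have h1 : x * S.v x t ≤ |S.v x t| :=
    (le_abs_self _).trans (by
      rw [abs_mul, abs_of_nonneg hx.1]
      exact mul_le_of_le_one_left (abs_nonneg _) hx.2)
  nlinarith [sq_abs (S.v x t), sq_nonneg (|S.v x t| - 1)]

theorem entropy_le {t : ℝ} (ht : 0 ≤ t) : S.entropy t ≤ S.E₀ + 1 / 2 := by
  rw [← S.integral_energy_density_add_half ht]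
  refine integral_mono_unit (continuousOn_slice S.continuousOn_entropy_density ht)
    (S.continuousOn_energy_density_add_half ht) fun x hx => ?_
  linarith [S.mul_v_le hx t, Real.log_le_sub_one_of_pos (S.hθ_pos x hx t ht)]

theorem exists_entropy_sub_le {ε : ℝ} (hε : 0 < ε) :
    ∃ a ≥ (1:ℝ), ∀ s ≥ a, ∀ t ≥ s, S.entropy t - S.entropy s ≤ ε := by
  have hbdd : BddAbove (S.entropy '' Ici 1) :=
    ⟨S.E₀ + 1 / 2, by rintro _ ⟨t, ht, rfl⟩; exact S.entropy_le (zero_le_one.trans ht)⟩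
  obtain ⟨_, ⟨a, ha, rfl⟩, h⟩ := exists_lt_of_lt_csSup (s := S.entropy '' Ici 1)
    ⟨_, 1, mem_Ici.2 le_rfl, rfl⟩ (sub_lt_self (sSup (S.entropy '' Ici 1)) hε)
  refine ⟨a, ha, fun s hs t ht => ?_⟩
  have h1 := le_csSup hbdd ⟨t, mem_Ici.2 (le_trans ha (hs.le.trans ht)), rfl⟩
  have h2 := S.entropy_mono (zero_lt_one.trans_le ha) hs
  linarith

/-! ### Pointwise bounds on `θ` and `u` -/

theorem exists_θ_le {t : ℝ} (ht : 0 ≤ t) : ∃ y ∈ Icc (0:ℝ) 1, S.θ y t ≤ S.E₀ + 1 := by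
  by_contra! h
  have h1 := integral_mono_unit continuousOn_const (continuousOn_slice S.hθ_cont ht)
    fun x hx => (h x hx).le
  have h2 := S.integral_θ_le ht
  simp only [intervalIntegral.integral_const, sub_zero, one_smul] at h1
  linarith

theorem exists_le_θ {t : ℝ} (ht : 1 ≤ t) :
    ∃ y ∈ Icc (0:ℝ) 1, exp (S.entropy 1 - (S.E₀ + 1 / 2) - 1) ≤ S.θ y t := by
  have ht0 : 0 ≤ t := zero_le_one.trans ht
  by_contra! h
  have h1 := integral_mono_unit (f := fun x => Real.log (S.θ x t) + x * S.v x t)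
    (g := fun x => (S.v x t ^ 2 / 2 + S.θ x t + 1 / 2) + (S.entropy 1 - (S.E₀ + 1 / 2) - 1))
    (continuousOn_slice S.continuousOn_entropy_density ht0)
    ((S.continuousOn_energy_density_add_half ht0).add
      continuousOn_const)
    fun x hx => by
      have h2 := (Real.log_lt_iff_lt_exp (S.hθ_pos x hx t ht0)).2 (h x hx)
      linarith [S.mul_v_le hx t, S.hθ_pos x hx t ht0]
  rw [intervalIntegral.integral_add
    ((S.continuousOn_energy_density_add_half ht0).intervalIntegrable_of_Icc zero_le_one)
    intervalIntegrable_const, S.integral_energy_density_add_half ht0] at h1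
  simp only [intervalIntegral.integral_const, sub_zero, one_smul] at h1
  change S.entropy t ≤ _ at h1
  have h3 := S.entropy_mono one_pos ht
  linarith

theorem integral_uθ_le {K t : ℝ} (ht : 0 ≤ t) (hK : ∀ x ∈ Icc (0:ℝ) 1, S.u x t ≤ K) :
    ∫ x in (0:ℝ)..1, S.u x t * S.θ x t ≤ K * S.E₀ := by
  have hθ := continuousOn_slice S.hθ_cont ht
  have hK0 : 0 ≤ K := (S.hu_pos 0 (by simp) t ht).le.trans (hK 0 (by simp))
  refine (integral_mono_unit (g := fun x => K * S.θ x t)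
    ((continuousOn_slice S.hu_cont ht).mul hθ)
    (continuousOn_const.mul hθ) fun x hx =>
    mul_le_mul_of_nonneg_right (hK x hx) (S.hθ_pos x hx t ht).le).trans ?_
  rw [intervalIntegral.integral_const_mul]
  exact mul_le_mul_of_nonneg_left (S.integral_θ_le ht) hK0

/-- Oscillation of `θ ^ ((1 + β) / 2)`. -/
theorem sq_sub_rpow_θ_le {K t : ℝ} (ht : 0 ≤ t) (hK : ∀ x ∈ Icc (0:ℝ) 1, S.u x t ≤ K)
    {x y : ℝ} (hx : x ∈ Icc (0:ℝ) 1) (hy : y ∈ Icc (0:ℝ) 1) :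
    (S.θ x t ^ ((1 + S.β) / 2) - S.θ y t ^ ((1 + S.β) / 2)) ^ 2
      ≤ ((1 + S.β) / 2) ^ 2 * (S.V t * (K * S.E₀)) := by
  set p := (1 + S.β) / 2 with hp
  have hθ := continuousOn_slice S.hθ_cont ht
  have hN : ContinuousOn (fun z => S.θx z t * S.θ z t ^ (p - 1)) (Icc 0 1) :=
    (continuousOn_slice S.hθx_cont ht).mul
      (hθ.rpow_const fun z hz => Or.inl (S.hθ_pos z hz t ht).ne')
  have h1 := abs_sub_le_integral_abs_deriv (F := fun z => S.θ z t ^ p)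
    (F' := fun z => p * (S.θx z t * S.θ z t ^ (p - 1)))
    (fun z hz => ((S.hθx z hz t ht).rpow_const (Or.inl (S.hθ_pos z hz t ht).ne')).congr_deriv
      (by ring)) (continuousOn_const.mul hN) hx hy
  have hp0 : 0 < p := by have := S.hβ; positivity
  simp only [abs_mul p, abs_of_pos hp0] at h1
  rw [intervalIntegral.integral_const_mul] at h1
  have h2 := sq_integral_le_mul_integral hN.abs (continuousOn_slice S.continuousOn_dissipation ht)
    ((continuousOn_slice S.hu_cont ht).mul hθ) (fun z hz => S.dissipation_nonneg hz ht)
    (fun z hz => (mul_pos (S.hu_pos z hz t ht) (S.hθ_pos z hz t ht)).le) (fun z hz => by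
      have hu := S.hu_pos z hz t ht
      have hθ := S.hθ_pos z hz t ht
      have hpow : (S.θ z t ^ (p - 1)) ^ 2 = S.θ z t ^ S.β / S.θ z t := by
        rw [← Real.rpow_natCast, ← Real.rpow_mul hθ.le, ← Real.rpow_sub_one hθ.ne']
        congr 1
        push_cast
        rw [hp]
        ring
      have heq : S.θ z t ^ S.β * S.θx z t ^ 2 / (S.u z t * S.θ z t ^ 2) * (S.u z t * S.θ z t)
          = S.θx z t ^ 2 * (S.θ z t ^ S.β / S.θ z t) := by
        field_simp
      rw [sq_abs, mul_pow, hpow, ← heq, dissipation]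
      refine mul_le_mul_of_nonneg_right (le_add_of_nonneg_right ?_) (by positivity)
      positivity)
  rw [← V_eq] at h2
  calc (S.θ x t ^ p - S.θ y t ^ p) ^ 2 = |S.θ x t ^ p - S.θ y t ^ p| ^ 2 := (sq_abs _).symm
    _ ≤ (p * ∫ z in (0:ℝ)..1, |S.θx z t * S.θ z t ^ (p - 1)|) ^ 2 :=
        pow_le_pow_left₀ (abs_nonneg _) h1 2
    _ = p ^ 2 * (∫ z in (0:ℝ)..1, |S.θx z t * S.θ z t ^ (p - 1)|) ^ 2 := mul_pow _ _ _
    _ ≤ p ^ 2 * (S.V t * (K * S.E₀)) := by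
        refine mul_le_mul_of_nonneg_left (h2.trans ?_) (sq_nonneg p)
        exact mul_le_mul_of_nonneg_left (S.integral_uθ_le ht hK) (S.V_nonneg ht)

theorem exists_θ_le_mul :
    ∃ C > 0, ∀ K t : ℝ, 0 ≤ t → (∀ x ∈ Icc (0:ℝ) 1, S.u x t ≤ K) →
      ∀ x ∈ Icc (0:ℝ) 1, S.θ x t ≤ C + C * K * S.V t := by
  have hβ := S.hβ
  have hE := S.E₀_nonneg
  set p := (1 + S.β) / 2 with hp
  have hp0 : 0 < p := by positivity
  set b := (S.E₀ + 1) ^ p with hb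
  have hb0 : 0 ≤ b := by positivity
  refine ⟨1 + 2 * b ^ 2 + 2 * p ^ 2 * S.E₀, by positivity, fun K t ht hK x hx => ?_⟩
  have hK0 : 0 ≤ K := (S.hu_pos 0 (by simp) t ht).le.trans (hK 0 (by simp))
  have hV := S.V_nonneg ht
  have hθ := S.hθ_pos x hx t ht
  obtain ⟨y, hy, hyE⟩ := S.exists_θ_le ht
  have h1 := S.sq_sub_rpow_θ_le ht hK hx hy
  rw [← hp] at h1
  have h2 : S.θ y t ^ p ≤ b := Real.rpow_le_rpow (S.hθ_pos y hy t ht).le hyE hp0.le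
  have h2' : 0 ≤ S.θ y t ^ p := Real.rpow_nonneg (S.hθ_pos y hy t ht).le _
  have h3 : S.θ x t ≤ 1 + (S.θ x t ^ p) ^ 2 := by
    rcases le_total (S.θ x t) 1 with h | h
    · nlinarith [sq_nonneg (S.θ x t ^ p)]
    · have h4 : S.θ x t ^ (1:ℝ) ≤ S.θ x t ^ (p * 2) :=
        Real.rpow_le_rpow_of_exponent_le h (by rw [hp]; linarith)
      rw [Real.rpow_one, Real.rpow_mul hθ.le, Real.rpow_two] at h4
      linarith
  have h5 : (S.θ x t ^ p) ^ 2 ≤ 2 * b ^ 2 + 2 * (p ^ 2 * (S.V t * (K * S.E₀))) := by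
    nlinarith [sq_nonneg (S.θ x t ^ p - 2 * S.θ y t ^ p), pow_le_pow_left₀ h2' h2 2]
  have h6 : 0 ≤ K * S.V t := mul_nonneg hK0 hV
  nlinarith [mul_nonneg h6 (add_nonneg zero_le_one (mul_nonneg zero_le_two (sq_nonneg b)))
    , mul_nonneg (mul_nonneg zero_le_two (sq_nonneg p)) hE]

theorem exists_sub_mul_le_θ {K : ℝ} (hK : ∀ t ≥ 1, ∀ x ∈ Icc (0:ℝ) 1, S.u x t ≤ K) :
    ∃ c > 0, ∃ C ≥ 0, ∀ t ≥ 1, ∀ x ∈ Icc (0:ℝ) 1, c - C * S.V t ≤ S.θ x t := by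
  have hβ := S.hβ
  have hE := S.E₀_nonneg
  have hK0 : 0 ≤ K := (S.hu_pos 0 (by simp) 1 (mem_Ici.2 zero_le_one)).le.trans
    (hK 1 le_rfl 0 (by simp))
  set p := (1 + S.β) / 2 with hp
  have hp0 : 0 < p := by positivity
  set b := exp (S.entropy 1 - (S.E₀ + 1 / 2) - 1) ^ p with hb
  have hb0 : 0 < b := Real.rpow_pos_of_pos (exp_pos _) _
  set c := (b / 2) ^ p⁻¹ with hc
  have hc0 : 0 < c := by positivity
  refine ⟨c, hc0, c * (4 * p ^ 2 * (K * S.E₀) / b ^ 2), by positivity, fun t ht x hx => ?_⟩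
  have ht0 : 0 ≤ t := zero_le_one.trans ht
  have hθ := S.hθ_pos x hx t ht0
  have hV := S.V_nonneg ht0
  obtain ⟨y, hy, hyE⟩ := S.exists_le_θ ht
  have h1 := S.sq_sub_rpow_θ_le ht0 (hK t ht) hx hy
  rw [← hp] at h1
  have h2 : b ≤ S.θ y t ^ p := Real.rpow_le_rpow (exp_pos _).le hyE hp0.le
  rcases le_total (b / 2) (S.θ x t ^ p) with h | h
  · have h3 : c ≤ S.θ x t := by
      have := Real.rpow_le_rpow (by positivity) h (inv_nonneg.2 hp0.le)
      rwa [Real.rpow_rpow_inv hθ.le hp0.ne'] at this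
    refine le_trans (sub_le_self _ ?_) h3
    positivity
  · have h3 : (b / 2) ^ 2 ≤ p ^ 2 * (S.V t * (K * S.E₀)) :=
      le_trans (by nlinarith) h1
    have h4 : 1 ≤ 4 * p ^ 2 * (K * S.E₀) / b ^ 2 * S.V t := by
      rw [div_mul_eq_mul_div, le_div_iff₀ (by positivity)]
      linarith
    nlinarith

/-- `u exp(-∫₀ˣ v)` relaxes towards `θ exp(-∫₀ˣ v)`. -/
theorem hasDerivAt_u_mul_exp {x : ℝ} (hx : x ∈ Icc (0:ℝ) 1) {t : ℝ} (ht : 0 < t) :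
    HasDerivAt (fun s => S.u x s * exp (-∫ ξ in (0:ℝ)..x, S.v ξ s))
      (-(S.u x t * exp (-∫ ξ in (0:ℝ)..x, S.v ξ t))
        + S.θ x t * exp (-∫ ξ in (0:ℝ)..x, S.v ξ t)) t := by
  have hsub : Icc 0 x ⊆ Icc 0 1 := Icc_subset_Icc_right hx.2
  have h := hasDerivAt_integral_strip S.hv_cont S.hvt_cont (fun x hx t ht => S.hasDerivAt_v hx ht)
    hx ht
  rw [integral_eq_sub_of_hasDerivWithinAt_Icc hx.1
    (fun y hy => (S.hasDerivWithinAt_stress (hsub hy) ht.le).mono hsub)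
    ((continuousOn_slice S.hvt_cont ht.le).mono hsub), S.stress_zero ht.le, sub_zero] at h
  refine ((S.hasDerivAt_u hx ht).mul h.neg.exp).congr_deriv ?_
  have hu := (S.hu_pos x hx t ht.le).ne'
  rw [stress, ← S.mass x hx t ht.le]
  simp only [Pi.neg_apply]
  field_simp
  ring

theorem exp_neg_le_exp_integral {x : ℝ} (hx : x ∈ Icc (0:ℝ) 1) {t : ℝ} (ht : 0 ≤ t) :
    exp (-(S.E₀ + 1 / 2)) ≤ exp (-∫ ξ in (0:ℝ)..x, S.v ξ t) :=
  exp_le_exp.2 (neg_le_neg (abs_le.1 (S.abs_integral_v_le hx ht)).2)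

theorem exp_integral_le_exp {x : ℝ} (hx : x ∈ Icc (0:ℝ) 1) {t : ℝ} (ht : 0 ≤ t) :
    exp (-∫ ξ in (0:ℝ)..x, S.v ξ t) ≤ exp (S.E₀ + 1 / 2) :=
  exp_le_exp.2 (neg_le.1 (abs_le.1 (S.abs_integral_v_le hx ht)).1)

theorem exists_u_le : ∃ K > 0, ∀ t ≥ 1, ∀ x ∈ Icc (0:ℝ) 1, S.u x t ≤ K := by
  obtain ⟨C, hC, hθ⟩ := S.exists_θ_le_mul
  set B := S.E₀ + 1 / 2 with hB
  set M := exp B with hM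
  have hM0 : 0 < M := exp_pos _
  obtain ⟨a, ha, hent⟩ := S.exists_entropy_sub_le (ε := 1 / (2 * M ^ 2 * C)) (by positivity)
  have ha0 : 0 < a := zero_lt_one.trans_le ha
  have hbox : ∀ T, Icc (0:ℝ) 1 ×ˢ Icc 1 T ⊆ Icc (0:ℝ) 1 ×ˢ Ici (0:ℝ) := fun T p hp =>
    ⟨hp.1, zero_le_one.trans hp.2.1⟩
  obtain ⟨K₀, hK₀⟩ := (isCompact_Icc.prod isCompact_Icc).exists_bound_of_continuousOn
    (S.hu_cont.mono (hbox a))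
  have hK₀' : ∀ t ∈ Icc 1 a, ∀ x ∈ Icc (0:ℝ) 1, S.u x t ≤ K₀ := fun t ht x hx =>
    (le_abs_self _).trans (hK₀ (x, t) ⟨hx, ht⟩)
  have hK₀0 : 0 < K₀ := (S.hu_pos 0 (by simp) a ha0.le).trans_le
    (hK₀' a ⟨ha, le_rfl⟩ 0 (by simp))
  refine ⟨K₀ + 2 * M ^ 2 * (K₀ + C), by positivity, fun T hT x hx => ?_⟩
  obtain ⟨⟨z, s⟩, hzs, hmax⟩ := (isCompact_Icc.prod isCompact_Icc).exists_isMaxOn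
    ⟨(x, T), ⟨hx, ⟨hT, le_rfl⟩⟩⟩ (S.hu_cont.mono (hbox T))
  have hmax' : ∀ t ∈ Icc 1 T, ∀ y ∈ Icc (0:ℝ) 1, S.u y t ≤ S.u z s := fun t ht y hy =>
    hmax (⟨hy, ht⟩ : (y, t) ∈ Icc (0:ℝ) 1 ×ˢ Icc 1 T)
  refine (hmax' T ⟨hT, le_rfl⟩ x hx).trans ?_
  have hz : z ∈ Icc (0:ℝ) 1 := hzs.1
  have hs : s ∈ Icc 1 T := hzs.2
  have hs0 : 0 < s := zero_lt_one.trans_le hs.1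
  have hus := S.hu_pos z hz s hs0.le
  rcases le_total s a with hsa | has
  · exact (hK₀' s ⟨hs.1, hsa⟩ z hz).trans (le_add_of_nonneg_right (by positivity))
  have hcmp := le_of_hasDerivAt_le_neg_self (a := M * C) (b := M * (C * S.u z s)) ha0 has
    (by positivity) (fun r hr => S.hasDerivAt_u_mul_exp hz hr) S.hasDerivAt_entropy
    (fun r hr => S.V_nonneg (le_of_lt hr)) fun r hr => by
      have hr0 : 0 ≤ r := ha0.le.trans hr.1
      have h1 := hθ _ r hr0 (hmax' r ⟨ha.trans hr.1, hr.2.trans hs.2⟩) z hz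
      have h2 := mul_le_mul h1 (S.exp_integral_le_exp hz hr0) (exp_pos _).le
        ((S.hθ_pos z hz r hr0).le.trans h1)
      linarith
  have he1 : exp (-(s - a)) ≤ 1 := exp_le_one_iff.2 (by linarith)
  have hua := S.hu_pos z hz a ha0.le
  have h3 : S.u z a * exp (-∫ ξ in (0:ℝ)..z, S.v ξ a) ≤ K₀ * M :=
    mul_le_mul (hK₀' a ⟨ha, le_rfl⟩ z hz) (S.exp_integral_le_exp hz ha0.le) (exp_pos _).le hK₀0.le
  have h4 : exp (-(s - a)) * (S.u z a * exp (-∫ ξ in (0:ℝ)..z, S.v ξ a) - M * C) ≤ K₀ * M := by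
    have : 0 < exp (-(s - a)) := exp_pos _
    have h5 : 0 ≤ exp (-(s - a)) * (M * C) := by positivity
    have h6 := mul_le_of_le_one_left
      (mul_pos hua (exp_pos (-∫ ξ in (0:ℝ)..z, S.v ξ a))).le he1
    linarith
  have h7 : M * (C * S.u z s) * (S.entropy s - S.entropy a) ≤ S.u z s / (2 * M) := by
    refine (mul_le_mul_of_nonneg_left (hent a le_rfl s has) (by positivity)).trans_eq ?_
    field_simp
  have h8 : S.u z s * M⁻¹ ≤ S.u z s * exp (-∫ ξ in (0:ℝ)..z, S.v ξ s) := by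
    refine mul_le_mul_of_nonneg_left ?_ hus.le
    rw [hM, ← Real.exp_neg]
    exact S.exp_neg_le_exp_integral hz hs0.le
  have h9 : S.u z s / (2 * M) = S.u z s * M⁻¹ / 2 := by field_simp
  have h10 : S.u z s * M⁻¹ ≤ 2 * (M * (K₀ + C)) := by linarith
  have h11 : S.u z s ≤ 2 * (M * (K₀ + C)) * M := by
    rwa [← div_eq_mul_inv, div_le_iff₀ hM0] at h10
  nlinarith

theorem exists_le_u : ∃ c > 0, ∃ a ≥ (1:ℝ), ∀ t ≥ a, ∀ x ∈ Icc (0:ℝ) 1, c ≤ S.u x t := by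
  obtain ⟨K, -, hK⟩ := S.exists_u_le
  obtain ⟨c, hc, C, hC, hθ⟩ := S.exists_sub_mul_le_θ hK
  set M := exp (S.E₀ + 1 / 2) with hM
  have hM0 : 0 < M := exp_pos _
  have hMinv : exp (-(S.E₀ + 1 / 2)) = M⁻¹ := Real.exp_neg _
  obtain ⟨a, ha, hent⟩ := S.exists_entropy_sub_le (ε := c * M⁻¹ / (4 * (M * C + 1)))
    (by positivity)
  have ha0 : 0 < a := zero_lt_one.trans_le ha
  refine ⟨c * M⁻¹ / 4 * M⁻¹, by positivity, a + 1, by linarith, fun t ht x hx => ?_⟩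
  have hat : a ≤ t := by linarith
  have ht0 : 0 ≤ t := ha0.le.trans hat
  have hcmp := le_of_hasDerivAt_le_neg_self (a := -(c * M⁻¹)) (b := M * C) ha0 hat
    (by positivity) (fun r hr => (S.hasDerivAt_u_mul_exp hx hr).neg) S.hasDerivAt_entropy
    (fun r hr => S.V_nonneg (le_of_lt hr)) fun r hr => by
      have hr0 : 0 ≤ r := ha0.le.trans hr.1
      have h1 := hθ r (ha.trans hr.1) x hx
      have h2 := S.exp_neg_le_exp_integral hx hr0
      rw [hMinv] at h2
      have h3 := S.exp_integral_le_exp hx hr0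
      have h4 := mul_le_mul_of_nonneg_right h1 (exp_pos (-∫ ξ in (0:ℝ)..x, S.v ξ r)).le
      have h5 := mul_le_mul_of_nonneg_left h2 hc.le
      have h6 := mul_le_mul_of_nonneg_left h3 (mul_nonneg hC (S.V_nonneg hr0))
      simp only [Pi.neg_apply]
      linarith
  simp only [Pi.neg_apply] at hcmp
  have he : exp (-(t - a)) ≤ 1 / 2 := by
    have h1 : exp (-(t - a)) ≤ exp (-1) := exp_le_exp.2 (by linarith)
    have h2 := Real.exp_neg_one_lt_d9
    linarith
  have hua := mul_pos (S.hu_pos x hx a ha0.le) (exp_pos (-∫ ξ in (0:ℝ)..x, S.v ξ a))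
  have hcM : 0 < c * M⁻¹ := by positivity
  have h7 : exp (-(t - a)) * (-(S.u x a * exp (-∫ ξ in (0:ℝ)..x, S.v ξ a)) - -(c * M⁻¹))
      ≤ c * M⁻¹ / 2 := by
    have h1 := mul_le_mul_of_nonneg_right he hcM.le
    have h2 := mul_pos (exp_pos (-(t - a))) hua
    linarith
  have h8 : M * C * (S.entropy t - S.entropy a) ≤ c * M⁻¹ / 4 := by
    have h1 := mul_le_mul_of_nonneg_left (hent a le_rfl t hat) (mul_nonneg hM0.le hC)
    refine h1.trans ?_
    rw [mul_div_assoc', div_le_div_iff₀ (by positivity) (by norm_num)]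
    nlinarith
  have h9 := mul_le_mul_of_nonneg_left (S.exp_integral_le_exp hx ht0) (S.hu_pos x hx t ht0).le
  have h10 : c * M⁻¹ / 4 ≤ S.u x t * M := by linarith
  rwa [← div_eq_mul_inv, div_le_iff₀ hM0]

/-! ### Decay of `w` -/

theorem hasDerivAt_primU {x : ℝ} (hx : x ∈ Icc (0:ℝ) 1) {t : ℝ} (ht : 0 < t) :
    HasDerivAt (S.primU x) (S.w x t) t := by
  have hv := continuousOn_slice S.hv_cont ht.le
  have hut : ContinuousOn (Function.uncurry fun x t => S.v x t - S.v 0 t - ∫ ξ in (0:ℝ)..x, S.u ξ t)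
      (Icc 0 1 ×ˢ Ici 0) :=
    (S.hv_cont.sub (S.hv_cont.comp (f := fun p : ℝ × ℝ => ((0:ℝ), p.2)) (by fun_prop)
      fun p hp => ⟨⟨le_rfl, zero_le_one⟩, hp.2⟩)).sub (continuousOn_primitive_strip S.hu_cont)
  have h1 : ∀ y ∈ Icc (0:ℝ) 1, ∀ s > 0, HasDerivAt (fun s => ∫ ξ in (0:ℝ)..y, S.u ξ s)
      (S.v y s - S.v 0 s - ∫ ξ in (0:ℝ)..y, S.u ξ s) s := by
    intro y hy s hs
    have hs0 : 0 ≤ s := le_of_lt hs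
    have hsub : Icc 0 y ⊆ Icc 0 1 := Icc_subset_Icc_right hy.2
    refine (hasDerivAt_integral_strip S.hu_cont S.hut_cont
      (fun x hx t ht => S.hasDerivAt_u hx ht) hy hs).congr_deriv ?_
    rw [← integral_eq_sub_of_hasDerivWithinAt_Icc hy.1
      (fun z hz => (S.hvx z (hsub hz) s hs0).mono hsub)
      ((continuousOn_slice S.hvx_cont hs0).mono hsub), ← intervalIntegral.integral_sub
      (((continuousOn_slice S.hvx_cont hs0).mono hsub).intervalIntegrable_of_Icc hy.1)
      (((continuousOn_slice S.hu_cont hs0).mono hsub).intervalIntegrable_of_Icc hy.1)]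
    refine intervalIntegral.integral_congr fun z hz => ?_
    rw [uIcc_of_le hy.1] at hz
    exact eq_sub_of_add_eq (S.mass z (hsub hz) s hs0)
  refine ((h1 x hx t ht).sub (hasDerivAt_integral_strip
    (continuousOn_primitive_strip S.hu_cont) hut h1 ⟨zero_le_one, le_rfl⟩ ht)).congr_deriv ?_
  rw [intervalIntegral.integral_sub
    ((hv.fun_sub continuousOn_const).intervalIntegrable_of_Icc zero_le_one)
    ((continuousOn_slice (continuousOn_primitive_strip S.hu_cont) ht.le).intervalIntegrable_of_Icc
      zero_le_one), intervalIntegral.integral_sub (hv.intervalIntegrable_of_Icc zero_le_one)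
    intervalIntegrable_const, S.integral_v ht.le, w]
  simp only [intervalIntegral.integral_const, sub_zero, one_smul]
  ring

theorem hasDerivAt_w {x : ℝ} (hx : x ∈ Icc (0:ℝ) 1) {t : ℝ} (ht : 0 < t) :
    HasDerivAt (S.w x) (S.vt x t - S.w x t) t := by
  have h := ((S.hasDerivAt_v hx ht).sub_const (∫ ξ in (0:ℝ)..1, S.v ξ 0)).sub
    (S.hasDerivAt_primU hx ht)
  exact h.congr_of_eventuallyEq (Eventually.of_forall fun s => S.w_eq x s)

theorem hasDerivWithinAt_w {x : ℝ} (hx : x ∈ Icc (0:ℝ) 1) {t : ℝ} (ht : 0 ≤ t) :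
    HasDerivWithinAt (fun y => S.w y t) (S.vx x t - S.u x t) (Icc 0 1) x := by
  have h : (fun y => S.w y t) = fun y => S.v y t - (∫ ξ in (0:ℝ)..1, S.v ξ 0) - S.primU y t :=
    funext fun y => S.w_eq y t
  rw [h]
  exact ((S.hvx x hx t ht).sub_const _).sub (S.hasDerivWithinAt_primU hx ht)

/-- Integration by parts against the stress, which vanishes at both ends. -/
theorem integral_vt_mul {φ φ' : ℝ → ℝ}
    (hφ : ∀ x ∈ Icc (0:ℝ) 1, HasDerivWithinAt φ (φ' x) (Icc 0 1) x)
    (hφ' : ContinuousOn φ' (Icc 0 1)) {t : ℝ} (ht : 0 ≤ t) :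
    ∫ x in (0:ℝ)..1, S.vt x t * φ x = -∫ x in (0:ℝ)..1, S.stress x t * φ' x := by
  have hc : ContinuousOn φ (Icc 0 1) := fun x hx => (hφ x hx).continuousWithinAt
  have hvt := (continuousOn_slice S.hvt_cont ht).fun_mul hc
  have hs := (continuousOn_slice S.continuousOn_stress ht).fun_mul hφ'
  have h := integral_eq_sub_of_hasDerivWithinAt_Icc zero_le_one
    (fun x hx => (S.hasDerivWithinAt_stress hx ht).fun_mul (hφ x hx)) (hvt.add hs)
  rw [intervalIntegral.integral_add (hvt.intervalIntegrable_of_Icc zero_le_one)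
    (hs.intervalIntegrable_of_Icc zero_le_one)] at h
  simp only [S.stress_zero ht, S.stress_one ht, zero_mul, sub_self] at h
  linarith

theorem abs_stress_mul_le {x t δ a : ℝ} (hx : x ∈ Icc (0:ℝ) 1) (ht : 0 ≤ t) (hδ : 0 < δ)
    (ha : a ^ 2 ≤ S.u x t ^ 2) :
    |S.stress x t * a| ≤ δ * (S.u x t * S.θ x t) + 1 / (4 * δ) * S.dissipation x t := by
  have hu := S.hu_pos x hx t ht
  have hθ := S.hθ_pos x hx t ht
  have h1 : (S.vx x t - S.θ x t) ^ 2 / (S.u x t * S.θ x t) ≤ S.dissipation x t :=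
    le_add_of_nonneg_left (by positivity)
  have h2 : |S.stress x t * a| ≤ |S.vx x t - S.θ x t| := by
    rw [stress, abs_mul, abs_div, abs_of_pos hu, div_mul_eq_mul_div, div_le_iff₀ hu]
    refine mul_le_mul_of_nonneg_left ?_ (abs_nonneg _)
    simpa [abs_of_pos hu] using sq_le_sq.1 ha
  refine h2.trans (le_trans ?_ (add_le_add_right (mul_le_mul_of_nonneg_left h1
    (by positivity : 0 ≤ 1 / (4 * δ))) _))
  set m := |S.vx x t - S.θ x t| with hm
  set q := S.u x t * S.θ x t with hq
  have hq0 : 0 < q := mul_pos hu hθ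
  rw [← sq_abs (S.vx x t - S.θ x t), ← hm]
  have h3 : δ * q + 1 / (4 * δ) * (m ^ 2 / q) - m = (2 * δ * q - m) ^ 2 / (4 * δ * q) := by
    field_simp
    ring
  have h4 : 0 ≤ (2 * δ * q - m) ^ 2 / (4 * δ * q) := by positivity
  linarith

theorem abs_primU_le {K t : ℝ} (ht : 0 ≤ t) (hK : ∀ x ∈ Icc (0:ℝ) 1, S.u x t ≤ K)
    {x : ℝ} (hx : x ∈ Icc (0:ℝ) 1) : |S.primU x t| ≤ K := by
  have hu := continuousOn_slice S.hu_cont ht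
  have hbound : ∀ y ∈ Icc (0:ℝ) 1, (∫ ξ in (0:ℝ)..y, S.u ξ t) ∈ Icc 0 K := by
    intro y hy
    have hpos : ∀ ξ ∈ Icc (0:ℝ) 1, 0 ≤ S.u ξ t := fun ξ hξ => (S.hu_pos ξ hξ t ht).le
    refine ⟨intervalIntegral.integral_nonneg hy.1 fun ξ hξ =>
      hpos ξ ⟨hξ.1, hξ.2.trans hy.2⟩, ?_⟩
    have h1 : ∫ ξ in (0:ℝ)..y, S.u ξ t ≤ ∫ _ in (0:ℝ)..y, K :=
      intervalIntegral.integral_mono_on hy.1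
        ((hu.mono (Icc_subset_Icc_right hy.2)).intervalIntegrable_of_Icc hy.1)
        intervalIntegrable_const fun ξ hξ => hK ξ ⟨hξ.1, hξ.2.trans hy.2⟩
    have hK0 : 0 ≤ K := (hpos y hy).trans (hK y hy)
    rw [intervalIntegral.integral_const, smul_eq_mul, sub_zero] at h1
    exact h1.trans (mul_le_of_le_one_left hK0 hy.2)
  have hc := continuousOn_slice (continuousOn_primitive_strip S.hu_cont) ht
  have h1 : ∫ y in (0:ℝ)..1, ∫ ξ in (0:ℝ)..y, S.u ξ t ≤ K := by
    simpa using integral_mono_unit hc continuousOn_const fun y hy => (hbound y hy).2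
  have h0 : 0 ≤ ∫ y in (0:ℝ)..1, ∫ ξ in (0:ℝ)..y, S.u ξ t :=
    intervalIntegral.integral_nonneg zero_le_one fun y hy => (hbound y hy).1
  have h2 := hbound x hx
  rw [primU, abs_le]
  constructor <;> linarith [h2.1, h2.2]

theorem integral_abs_w_le {K t : ℝ} (ht : 0 ≤ t) (hK : ∀ x ∈ Icc (0:ℝ) 1, S.u x t ≤ K) :
    ∫ x in (0:ℝ)..1, |S.w x t| ≤ S.E₀ + 1 / 2 + |∫ ξ in (0:ℝ)..1, S.v ξ 0| + K := by
  have hv := (continuousOn_slice S.hv_cont ht).abs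
  have h := integral_mono_unit (continuousOn_slice S.continuousOn_w ht).abs
    (g := fun x => |S.v x t| + (|∫ ξ in (0:ℝ)..1, S.v ξ 0| + K))
    (hv.add continuousOn_const) fun x hx => by
      rw [S.w_eq]
      have h1 := abs_sub (S.v x t - ∫ ξ in (0:ℝ)..1, S.v ξ 0) (S.primU x t)
      have h2 := abs_sub (S.v x t) (∫ ξ in (0:ℝ)..1, S.v ξ 0)
      linarith [S.abs_primU_le ht hK hx]
  rw [intervalIntegral.integral_add (hv.intervalIntegrable_of_Icc zero_le_one)
    intervalIntegrable_const] at h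
  simp only [intervalIntegral.integral_const, sub_zero, one_smul] at h
  linarith [S.integral_abs_v_le ht]

theorem abs_integral_stress_mul_le {K L t δ : ℝ} {a : ℝ → ℝ} (ht : 0 ≤ t) (hδ : 0 < δ)
    (hK : ∀ x ∈ Icc (0:ℝ) 1, S.u x t ≤ K) (hL : 0 < L) (ha : ContinuousOn a (Icc 0 1))
    (haL : ∀ x ∈ Icc (0:ℝ) 1, a x ^ 2 ≤ (L * S.u x t) ^ 2) :
    |∫ x in (0:ℝ)..1, S.stress x t * a x| ≤ L * (δ * (K * S.E₀) + 1 / (4 * δ) * S.V t) := by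
  have hd := continuousOn_slice S.continuousOn_dissipation ht
  have huθ := (continuousOn_slice S.hu_cont ht).fun_mul (continuousOn_slice S.hθ_cont ht)
  have hs := (continuousOn_slice S.continuousOn_stress ht).fun_mul ha
  refine (intervalIntegral.abs_integral_le_integral_abs zero_le_one).trans ?_
  have h := integral_mono_unit hs.abs
    (g := fun x => (L * δ) * (S.u x t * S.θ x t) + (L * (1 / (4 * δ))) * S.dissipation x t)
    ((continuousOn_const.mul huθ).add (continuousOn_const.mul hd)) fun x hx => by
      have h1 := S.abs_stress_mul_le (a := a x / L) hx ht hδ (by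
        rw [div_pow, div_le_iff₀ (by positivity), ← mul_pow, mul_comm (S.u x t)]
        exact haL x hx)
      have h2 : S.stress x t * a x = L * (S.stress x t * (a x / L)) := by field_simp
      have h3 := mul_le_mul_of_nonneg_left h1 hL.le
      rw [h2, abs_mul, abs_of_pos hL]
      linarith
  rw [integral_unit_add_mul huθ hd, ← V_eq] at h
  refine h.trans ?_
  have := mul_le_mul_of_nonneg_left (S.integral_uθ_le ht hK) (mul_pos hL hδ).le
  linarith

theorem hasDerivAt_integral_w_mul {φ : ℝ → ℝ} (hφ : ContinuousOn φ (Icc 0 1)) {t : ℝ}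
    (ht : 0 < t) :
    HasDerivAt (fun s => ∫ x in (0:ℝ)..1, S.w x s * φ x)
      ((∫ x in (0:ℝ)..1, S.vt x t * φ x) - ∫ x in (0:ℝ)..1, S.w x t * φ x) t := by
  have hφ' : ContinuousOn (fun p : ℝ × ℝ => φ p.1) (Icc 0 1 ×ˢ Ici 0) :=
    hφ.comp continuousOn_fst fun p hp => hp.1
  refine (hasDerivAt_integral_strip (F := fun x s => S.w x s * φ x)
    (F' := fun x s => (S.vt x s - S.w x s) * φ x) (S.continuousOn_w.mul hφ')
    ((S.hvt_cont.sub S.continuousOn_w).mul hφ')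
    (fun x hx s hs => (S.hasDerivAt_w hx hs).mul_const _) ⟨zero_le_one, le_rfl⟩ ht).congr_deriv ?_
  rw [← intervalIntegral.integral_sub
    (((continuousOn_slice S.hvt_cont ht.le).fun_mul hφ).intervalIntegrable_of_Icc zero_le_one)
    (((continuousOn_slice S.continuousOn_w ht.le).fun_mul hφ).intervalIntegrable_of_Icc zero_le_one)]
  simp only [sub_mul]

/-- `w` is asymptotically orthogonal to the mean-free primitive of `u`. -/
theorem tendsto_integral_w_mul_primU :
    Tendsto (fun t => ∫ x in (0:ℝ)..1, S.w x t * S.primU x t) atTop (𝓝 0) := by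
  obtain ⟨K, hK0, hK⟩ := S.exists_u_le
  obtain ⟨c, hc, a₀, ha₀, hu⟩ := S.exists_le_u
  have hE := S.E₀_nonneg
  set L := K / c with hL
  have hL0 : 0 < L := by positivity
  set D := K * (S.E₀ + 1 / 2 + |∫ ξ in (0:ℝ)..1, S.v ξ 0| + K) with hD
  have key : ∀ δ > 0, ∀ a ≥ a₀, ∀ T ≥ a, |∫ x in (0:ℝ)..1, S.w x T * S.primU x T|
      ≤ exp (-(T - a)) * D + L * (δ * (K * S.E₀))
        + L * (1 / (4 * δ)) * (S.entropy T - S.entropy a) := by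
    intro δ hδ a ha T hT
    have ha0 : 0 < a := zero_lt_one.trans_le (ha₀.trans ha)
    have hT1 : 1 ≤ T := ha₀.trans (ha.le.trans hT)
    have hT0 : 0 ≤ T := zero_le_one.trans hT1
    have hφ := continuousOn_slice S.continuousOn_primU hT0
    have huT := continuousOn_slice S.hu_cont hT0
    have hst : ∀ r ∈ Icc a T, |∫ x in (0:ℝ)..1, S.vt x r * S.primU x T|
        ≤ L * (δ * (K * S.E₀) + 1 / (4 * δ) * S.V r) := by
      intro r hr
      have hr0 : 0 ≤ r := ha0.le.trans hr.1
      rw [S.integral_vt_mul (fun x hx => S.hasDerivWithinAt_primU hx hT0) huT hr0, abs_neg]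
      refine S.abs_integral_stress_mul_le hr0 hδ (hK r (ha₀.trans (ha.le.trans hr.1))) hL0 huT
        fun x hx => pow_le_pow_left₀ (S.hu_pos x hx T hT0).le ?_ 2
      refine (hK T hT1 x hx).trans ?_
      have := mul_le_mul_of_nonneg_left (hu r (ha.le.trans hr.1) x hx) hL0.le
      rwa [hL, div_mul_cancel₀ _ hc.ne', ← hL] at this
    have hya : |∫ x in (0:ℝ)..1, S.w x a * S.primU x T| ≤ D := by
      have hwa := continuousOn_slice S.continuousOn_w ha0.le
      refine (intervalIntegral.abs_integral_le_integral_abs zero_le_one).trans ?_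
      refine (integral_mono_unit (g := fun x => K * |S.w x a|) (hwa.mul hφ).abs
        (continuousOn_const.mul hwa.abs) fun x hx => ?_).trans ?_
      · have := mul_le_mul_of_nonneg_left (S.abs_primU_le hT0 (hK T hT1) hx) (abs_nonneg (S.w x a))
        simp only [Pi.mul_apply]
        rw [abs_mul]
        linarith
      · rw [intervalIntegral.integral_const_mul]
        exact mul_le_mul_of_nonneg_left
          (S.integral_abs_w_le ha0.le (hK a (ha₀.trans ha))) hK0.le
    have hα : 0 ≤ exp (-(T - a)) * (L * (δ * (K * S.E₀))) := by positivity
    have hexp := exp_pos (-(T - a))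
    have hya' := abs_le.1 hya
    have h1 := le_of_hasDerivAt_le_neg_self (a := L * (δ * (K * S.E₀)))
      (b := L * (1 / (4 * δ))) ha0 hT (by positivity)
      (fun r hr => S.hasDerivAt_integral_w_mul hφ hr) S.hasDerivAt_entropy
      (fun r hr => S.V_nonneg (le_of_lt hr)) fun r hr => by
        linarith [(abs_le.1 (hst r hr)).2]
    have h2 := le_of_hasDerivAt_le_neg_self (a := L * (δ * (K * S.E₀)))
      (b := L * (1 / (4 * δ))) ha0 hT (by positivity)
      (fun r hr => (S.hasDerivAt_integral_w_mul hφ hr).neg) S.hasDerivAt_entropy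
      (fun r hr => S.V_nonneg (le_of_lt hr)) fun r hr => by
        simp only [Pi.neg_apply]
        linarith [(abs_le.1 (hst r hr)).1]
    simp only [Pi.neg_apply] at h2
    have h3 := mul_le_mul_of_nonneg_left hya'.1 hexp.le
    have h4 := mul_le_mul_of_nonneg_left hya'.2 hexp.le
    rw [abs_le]
    constructor <;> linarith
  rw [Metric.tendsto_atTop]
  intro ε hε
  set δ := ε / (4 * (L * (K * S.E₀) + 1)) with hδ
  have hδ0 : 0 < δ := by positivity
  have h1 : L * (δ * (K * S.E₀)) ≤ ε / 4 := by
    rw [hδ, mul_left_comm, div_mul_eq_mul_div, div_le_div_iff₀ (by positivity) (by norm_num)]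
    nlinarith
  obtain ⟨a₁, ha₁, hent⟩ := S.exists_entropy_sub_le (ε := ε / 4 / (L * (1 / (4 * δ))))
    (by positivity)
  set a := max a₀ a₁ with ha
  have hlim : Tendsto (fun T => exp (-(T - a)) * D) atTop (𝓝 0) := by
    have h : Tendsto (fun T => exp (-(T - a))) atTop (𝓝 0) :=
      Real.tendsto_exp_neg_atTop_nhds_zero.comp (tendsto_atTop_add_const_right _ (-a) tendsto_id)
    simpa using h.mul_const D
  obtain ⟨T₀, hT₀⟩ := eventually_atTop.1 (hlim.eventually (gt_mem_nhds (by positivity : 0 < ε / 4)))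
  refine ⟨max T₀ a, fun T hT => ?_⟩
  have haT : a ≤ T := (le_max_right _ _).trans hT
  have h2 := key δ hδ0 a (le_max_left _ _) T haT
  have h3 := hT₀ T ((le_max_left _ _).trans hT)
  have h4 := mul_le_mul_of_nonneg_left (hent a (le_max_right _ _) T haT)
    (by positivity : 0 ≤ L * (1 / (4 * δ)))
  rw [mul_div_cancel₀ _ (by positivity)] at h4
  rw [Real.dist_eq, sub_zero]
  linarith

theorem hasDerivAt_integral_w_mul_primU {t : ℝ} (ht : 0 < t) :
    HasDerivAt (fun s => ∫ x in (0:ℝ)..1, S.w x s * S.primU x s)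
      ((∫ x in (0:ℝ)..1, S.w x t ^ 2) - (∫ x in (0:ℝ)..1, S.stress x t * S.u x t)
        - ∫ x in (0:ℝ)..1, S.w x t * S.primU x t) t := by
  have hP := S.continuousOn_primU
  have hw := S.continuousOn_w
  have hPt := continuousOn_slice hP ht.le
  have hwt := continuousOn_slice hw ht.le
  have hvt := continuousOn_slice S.hvt_cont ht.le
  refine (hasDerivAt_integral_strip (F := fun x s => S.w x s * S.primU x s)
    (F' := fun x s => S.vt x s * S.primU x s + S.w x s ^ 2 - S.w x s * S.primU x s) (hw.mul hP)
    (((S.hvt_cont.fun_mul hP).fun_add (hw.fun_pow 2)).fun_sub (hw.fun_mul hP))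
    (fun x hx s hs => ((S.hasDerivAt_w hx hs).mul (S.hasDerivAt_primU hx hs)).congr_deriv
      (by ring)) ⟨zero_le_one, le_rfl⟩ ht).congr_deriv ?_
  have i1 := (hvt.fun_mul hPt).intervalIntegrable_of_Icc (μ := volume) zero_le_one
  have i2 := (hwt.fun_pow 2).intervalIntegrable_of_Icc (μ := volume) zero_le_one
  have i3 := (hwt.fun_mul hPt).intervalIntegrable_of_Icc (μ := volume) zero_le_one
  have h := intervalIntegral.integral_sub (i1.add i2) i3
  have h' := intervalIntegral.integral_add i1 i2
  rw [h, h', S.integral_vt_mul (fun x hx => S.hasDerivWithinAt_primU hx ht.le)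
    (continuousOn_slice S.hu_cont ht.le) ht.le]
  ring

theorem hasDerivAt_integral_w_sq {t : ℝ} (ht : 0 < t) :
    HasDerivAt (fun s => ∫ x in (0:ℝ)..1, S.w x s ^ 2)
      (-2 * (∫ x in (0:ℝ)..1, S.stress x t * (S.vx x t - S.u x t))
        + -2 * ∫ x in (0:ℝ)..1, S.w x t ^ 2) t := by
  have hw := S.continuousOn_w
  have hwt := continuousOn_slice hw ht.le
  have hvt := continuousOn_slice S.hvt_cont ht.le
  refine (hasDerivAt_integral_strip (F := fun x s => S.w x s ^ 2)
    (F' := fun x s => 2 * (S.vt x s * S.w x s) + (-2) * S.w x s ^ 2) (hw.fun_pow 2)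
    ((continuousOn_const.fun_mul (S.hvt_cont.fun_mul hw)).fun_add
      (continuousOn_const.fun_mul (hw.fun_pow 2)))
    (fun x hx s hs => ((S.hasDerivAt_w hx hs).pow 2).congr_deriv
      (by push_cast; ring)) ⟨zero_le_one, le_rfl⟩ ht).congr_deriv ?_
  rw [integral_unit_add_mul (hvt.fun_mul hwt) (hwt.fun_pow 2)]
  have := S.integral_vt_mul (fun x hx => S.hasDerivWithinAt_w hx ht.le)
    ((continuousOn_slice S.hvx_cont ht.le).sub (continuousOn_slice S.hu_cont ht.le)) ht.le
  rw [this]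
  ring

/-- The growth rate of `‖w‖²` is controlled by the dissipation. -/
theorem exists_deriv_integral_w_sq_le :
    ∃ C > 0, ∃ a ≥ (1:ℝ), ∀ t ≥ a,
      -2 * (∫ x in (0:ℝ)..1, S.stress x t * (S.vx x t - S.u x t))
        + -2 * (∫ x in (0:ℝ)..1, S.w x t ^ 2) ≤ C + C * S.V t := by
  obtain ⟨K, hK0, hK⟩ := S.exists_u_le
  obtain ⟨c, hc, a, ha, hu⟩ := S.exists_le_u
  obtain ⟨C, hC, hθ⟩ := S.exists_θ_le_mul
  have hE := S.E₀_nonneg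
  refine ⟨K + C * S.E₀ / c + C * K * S.E₀ / c, by positivity, a, ha, fun t ht => ?_⟩
  have ht1 : 1 ≤ t := ha.trans ht
  have ht0 : 0 ≤ t := zero_le_one.trans ht1
  have hV := S.V_nonneg ht0
  have hst := (continuousOn_slice S.continuousOn_stress ht0).mul
    ((continuousOn_slice S.hvx_cont ht0).sub (continuousOn_slice S.hu_cont ht0))
  have hθc := continuousOn_slice S.hθ_cont ht0
  have h1 := integral_mono_unit
    (f := fun x => -2 * (S.stress x t * (S.vx x t - S.u x t)))
    (g := fun x => 1 * K + ((C + C * K * S.V t) / c) * S.θ x t) (continuousOn_const.mul hst)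
    ((continuousOn_const.mul continuousOn_const).add (continuousOn_const.mul hθc)) fun x hx => by
      have hux := S.hu_pos x hx t ht0
      have hθx := S.hθ_pos x hx t ht0
      have h2 : S.vx x t = S.stress x t * S.u x t + S.θ x t := by
        rw [stress]
        field_simp
        ring
      have h3 : -2 * (S.stress x t * (S.vx x t - S.u x t)) ≤ S.u x t + S.θ x t ^ 2 / S.u x t := by
        have h4 : S.u x t + S.θ x t ^ 2 / S.u x t
            = (S.θ x t - S.u x t) ^ 2 / S.u x t + 2 * S.θ x t := by
          field_simp
          ring
        have h5 : (S.θ x t - S.u x t) ^ 2 / S.u x t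
            + 2 * (S.stress x t * (S.vx x t - S.u x t)) =
            ((S.θ x t - S.u x t) + S.stress x t * S.u x t) ^ 2 / S.u x t
              + S.stress x t ^ 2 * S.u x t := by
          rw [h2]
          field_simp
          ring
        have h6 : 0 ≤ ((S.θ x t - S.u x t) + S.stress x t * S.u x t) ^ 2 / S.u x t
              + S.stress x t ^ 2 * S.u x t := by positivity
        linarith
      have h4 : S.θ x t ^ 2 / S.u x t ≤ (C + C * K * S.V t) / c * S.θ x t := by
        rw [div_mul_eq_mul_div]
        refine div_le_div₀ (by positivity) ?_ hc (hu t ht x hx)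
        rw [pow_two]
        exact mul_le_mul_of_nonneg_right (hθ K t ht0 (hK t ht1) x hx) hθx.le
      linarith [hK t ht1 x hx]
  rw [integral_unit_add_mul continuousOn_const hθc, intervalIntegral.integral_const_mul] at h1
  simp only [intervalIntegral.integral_const, sub_zero, one_smul, one_mul] at h1
  have h2 := mul_le_mul_of_nonneg_left (S.integral_θ_le ht0)
    (by positivity : 0 ≤ (C + C * K * S.V t) / c)
  have h3 : 0 ≤ ∫ x in (0:ℝ)..1, S.w x t ^ 2 :=
    intervalIntegral.integral_nonneg zero_le_one fun x _ => sq_nonneg _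
  have h4 : (C + C * K * S.V t) / c * S.E₀ = C * S.E₀ / c + C * K * S.E₀ / c * S.V t := by
    field_simp
  have h5 : 0 ≤ (K + C * S.E₀ / c) * S.V t := by positivity
  have h6 : 0 ≤ C * K * S.E₀ / c := by positivity
  linarith

end NSSol

/-- Decay of `w` in `L²`: `∫₀¹ w(x,t)² dx → 0` as `t → ∞`. -/
theorem w_L2_decay (S : NSSol) :
    Tendsto (fun t => ∫ x in (0:ℝ)..1, (S.w x t) ^ 2) atTop (𝓝 0) := by
  obtain ⟨K, hK0, hK⟩ := S.exists_u_le
  obtain ⟨C, hC, a₀, ha₀, hderiv⟩ := S.exists_deriv_integral_w_sq_le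
  have hE := S.E₀_nonneg
  have key : ∀ δ > 0, ∀ η > 0, ∀ ρ : ℝ, ∀ s ≥ a₀, ∀ ω : ℝ,
      (∀ r ≥ s, |∫ x in (0:ℝ)..1, S.w x r * S.primU x r| ≤ ρ) →
      S.entropy (s + η) - S.entropy s ≤ ω →
      η * ∫ x in (0:ℝ)..1, S.w x (s + η) ^ 2
        ≤ 2 * ρ + η * (C * η + C * ω + ρ + δ * (K * S.E₀)) + 1 / (4 * δ) * ω := by
    intro δ hδ η hη ρ s hs ω hρ hω
    have hs0 : 0 < s := zero_lt_one.trans_le (ha₀.trans hs)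
    set t := s + η with ht
    have hst : s ≤ t := by linarith
    have hback : ∀ r ∈ Icc s t, (∫ x in (0:ℝ)..1, S.w x t ^ 2)
        ≤ (∫ x in (0:ℝ)..1, S.w x r ^ 2) + C * η + C * ω := by
      intro r hr
      have h1 := le_of_hasDerivAt_le (hs0.trans_le hr.1) hr.2
        (fun q hq => S.hasDerivAt_integral_w_sq hq) S.hasDerivAt_entropy
        fun q hq => hderiv q (hs.le.trans (hr.1.trans hq.1))
      have h2 := S.entropy_mono hs0 hr.1
      have h3 : C * (t - r) ≤ C * η := mul_le_mul_of_nonneg_left (by linarith [hr.1]) hC.le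
      have h4 : C * (S.entropy t - S.entropy r) ≤ C * ω :=
        mul_le_mul_of_nonneg_left (by linarith) hC.le
      linarith
    have h1 := le_of_hasDerivAt_le hs0 hst
      (fun q hq => (S.hasDerivAt_integral_w_mul_primU hq).neg) S.hasDerivAt_entropy
      (a := -(∫ x in (0:ℝ)..1, S.w x t ^ 2) + (C * η + C * ω + ρ + δ * (K * S.E₀)))
      (b := 1 / (4 * δ)) fun r hr => by
        have hr0 : 0 ≤ r := hs0.le.trans hr.1
        have h2 := S.abs_integral_stress_mul_le hr0 hδ
          (hK r (ha₀.trans (hs.le.trans hr.1))) one_pos (continuousOn_slice S.hu_cont hr0)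
          fun x _ => by rw [one_mul]
        linarith [hback r hr, (abs_le.1 h2).2, (abs_le.1 (hρ r hr.1)).2]
    have h2 : 1 / (4 * δ) * (S.entropy t - S.entropy s) ≤ 1 / (4 * δ) * ω :=
      mul_le_mul_of_nonneg_left hω (by positivity)
    have h3 : t - s = η := by rw [ht]; ring
    rw [h3] at h1
    simp only [Pi.neg_apply] at h1
    linarith [(abs_le.1 (hρ s le_rfl)).1, (abs_le.1 (hρ t hst)).2]
  rw [Metric.tendsto_atTop]
  intro ε hε
  set δ := ε / (8 * (K * S.E₀ + 1)) with hδ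
  have hδ0 : 0 < δ := by positivity
  have hδE : δ * (K * S.E₀) ≤ ε / 8 := by
    rw [hδ, div_mul_eq_mul_div, div_le_div_iff₀ (by positivity) (by norm_num)]
    nlinarith
  set η := ε / (8 * C) with hη
  have hη0 : 0 < η := by positivity
  have hCη : C * η = ε / 8 := by rw [hη]; field_simp
  set ρ := η * (ε / 8) / (2 + η) with hρ
  have hρ0 : 0 < ρ := by positivity
  have hρη : 2 * ρ + η * ρ = η * (ε / 8) := by rw [hρ]; field_simp
  set ω := η * (ε / 8) / (η * C + 1 / (4 * δ)) with hω
  have hω0 : 0 < ω := by positivity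
  have hωη : η * (C * ω) + 1 / (4 * δ) * ω = η * (ε / 8) := by
    have h : (η * C + 1 / (4 * δ)) * ω = η * (ε / 8) := mul_div_cancel₀ _ (by positivity)
    linarith
  obtain ⟨a₁, ha₁, hent⟩ := S.exists_entropy_sub_le hω0
  obtain ⟨a₂, ha₂⟩ := Metric.tendsto_atTop.1 S.tendsto_integral_w_mul_primU ρ hρ0
  refine ⟨max a₀ (max a₁ a₂) + η, fun t ht => ?_⟩
  obtain ⟨s, rfl⟩ : ∃ s, t = s + η := ⟨t - η, by ring⟩
  have hs : max a₀ (max a₁ a₂) ≤ s := by linarith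
  have hs0 : a₀ ≤ s := (le_max_left _ _).trans hs
  have hs1 : a₁ ≤ s := (le_max_left _ _).trans ((le_max_right _ _).trans hs)
  have hs2 : a₂ ≤ s := (le_max_right _ _).trans ((le_max_right _ _).trans hs)
  have h1 := key δ hδ0 η hη0 ρ s hs0 ω (fun r hr => by
    have := ha₂ r (hs2.trans hr)
    rw [Real.dist_eq, sub_zero] at this
    exact this.le) (hent s hs1 _ (by linarith))
  have h2 : η * ∫ x in (0:ℝ)..1, S.w x (s + η) ^ 2 ≤ η * (ε / 2) := by
    have h3 := mul_le_mul_of_nonneg_left hδE hη0.le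
    have h4 : η * (C * η) = η * (ε / 8) := by rw [hCη]
    linarith
  have h3 := le_of_mul_le_mul_left h2 hη0
  have h4 : 0 ≤ ∫ x in (0:ℝ)..1, S.w x (s + η) ^ 2 :=
    intervalIntegral.integral_nonneg zero_le_one fun x _ => sq_nonneg _
  rw [Real.dist_eq, sub_zero, abs_of_nonneg h4]
  linarith
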